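/- arXiv:0912.3640 — 5 statements merged into one kernel-verified Lean document; each statement's English description precedes it below -/
import Mathlib

section
/- Let V be a 5-dimensional real vector space, α a linear functional on V, and β an alternating bilinear form on V such that the 5-form α ∧ β ∧ β is nonzero. Let R ∈ V satisfy α(R) = 1 and β(R, v) = 0 for all v ∈ V. If ω is an alternating bilinear form on V such that the 4-form ω ∧ β = 0 and the 4-form ω ∧ ω ≠ 0, then ω(R, v) = 0 for all v ∈ V (i.e. ω is horizontal). -/
open Finset

/-- The wedge product of two alternating 2-forms, as an alternating 4-form, given by the
sum over (2,2)-shuffles: `(φ∧ψ)(v₁,…,v₄) = Σ sgn(σ)·φ(v_{σ1},v_{σ2})·ψ(v_{σ3},v_{σ4})`. -/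
def wedge22 {V : Type*} (φ ψ : V → V → ℝ) (v₁ v₂ v₃ v₄ : V) : ℝ :=
  φ v₁ v₂ * ψ v₃ v₄ - φ v₁ v₃ * ψ v₂ v₄ + φ v₁ v₄ * ψ v₂ v₃
    + φ v₂ v₃ * ψ v₁ v₄ - φ v₂ v₄ * ψ v₁ v₃ + φ v₃ v₄ * ψ v₁ v₂

/-- The wedge product `α ∧ φ ∧ ψ` of a 1-form with two 2-forms, as a 5-form (written as the
full antisymmetrization over all permutations, which for alternating `φ, ψ` equals
`1!·2!·2! = 4` times the shuffle sum). -/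
def wedge122 {V : Type*} (α : V → ℝ) (φ ψ : V → V → ℝ) (v : Fin 5 → V) : ℝ :=
  ∑ σ : Equiv.Perm (Fin 5),
    ((Equiv.Perm.sign σ : ℤ) : ℝ) *
      (α (v (σ 0)) * (φ (v (σ 1)) (v (σ 2)) * ψ (v (σ 3)) (v (σ 4))))

/-- A signed sum over permutations vanishes when the summand is invariant under
precomposition with a transposition. -/
lemma sum_sign_mul_eq_zero_of_swap {n : Type*} [Fintype n] [DecidableEq n] {i j : n}
    (hij : i ≠ j) (f : Equiv.Perm n → ℝ) (hf : ∀ σ, f (σ * Equiv.swap i j) = f σ) :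
    ∑ σ : Equiv.Perm n, ((Equiv.Perm.sign σ : ℤ) : ℝ) * f σ = 0 := by
  have h := Equiv.sum_comp (Equiv.mulRight (Equiv.swap i j))
    (fun σ : Equiv.Perm n => ((Equiv.Perm.sign σ : ℤ) : ℝ) * f σ)
  simp only [Equiv.coe_mulRight, Equiv.Perm.sign_mul, Equiv.Perm.sign_swap hij, hf, mul_neg,
    mul_one, Units.val_neg, Int.cast_neg, neg_mul, Finset.sum_neg_distrib] at h
  linarith

/-- The form `α ∧ φ ∧ φ` vanishes when `φ = l ∧ m` is decomposable. -/
lemma wedge122_self_eq_zero_of_decomposable {V : Type*} (α l m : V → ℝ) (φ : V → V → ℝ)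
    (hφ : ∀ a b, φ a b = l a * m b - l b * m a) : wedge122 α φ φ = 0 := by
  funext v
  have key (i j k p : Fin 5) (hik : i ≠ k) (hi : i ≠ 0) (hk : k ≠ 0) (hij : j ≠ i)
      (hjk : j ≠ k) (hpi : p ≠ i) (hpk : p ≠ k) :=
    sum_sign_mul_eq_zero_of_swap hik
      (fun σ => α (v (σ 0)) * (l (v (σ i)) * m (v (σ j)) * (l (v (σ k)) * m (v (σ p)))))
      (fun σ => by
        simp only [Equiv.Perm.mul_apply, Equiv.swap_apply_left, Equiv.swap_apply_right,
          Equiv.swap_apply_of_ne_of_ne hi.symm hk.symm, Equiv.swap_apply_of_ne_of_ne hij hjk,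
          Equiv.swap_apply_of_ne_of_ne hpi hpk]
        ring)
  have e1 := key 1 2 3 4 (by decide) (by decide) (by decide) (by decide) (by decide)
    (by decide) (by decide)
  have e2 := key 1 2 4 3 (by decide) (by decide) (by decide) (by decide) (by decide)
    (by decide) (by decide)
  have e3 := key 2 1 3 4 (by decide) (by decide) (by decide) (by decide) (by decide)
    (by decide) (by decide)
  have e4 := key 2 1 4 3 (by decide) (by decide) (by decide) (by decide) (by decide)
    (by decide) (by decide)
  have e := congrArg₂ (· + ·) (congrArg₂ (· - ·) (congrArg₂ (· - ·) e1 e2) e3) e4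
  simp only [← Finset.sum_sub_distrib, ← Finset.sum_add_distrib, sub_zero, add_zero] at e
  refine Eq.trans (Finset.sum_congr rfl fun σ _ => ?_) e
  rw [hφ, hφ]
  ring

/-- On a 5-dimensional real vector space with a contact-type pair `(α, β)`
(`α ∧ β ∧ β ≠ 0`) and Reeb vector `R` (`α R = 1`, `ι_R β = 0`), any alternating 2-form `ω`
with `ω ∧ β = 0` and `ω ∧ ω ≠ 0` is horizontal: `ω(R, ·) = 0`. -/
theorem stmt2 (V : Type*) [AddCommGroup V] [Module ℝ V]
    [FiniteDimensional ℝ V] (hdim : Module.finrank ℝ V = 5)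
    (α : V →ₗ[ℝ] ℝ) (β : V →ₗ[ℝ] V →ₗ[ℝ] ℝ) (hβ : ∀ v : V, β v v = 0)
    (hcontact : wedge122 (fun v => α v) (fun v w => β v w) (fun v w => β v w) ≠ 0)
    (R : V) (hR1 : α R = 1) (hR2 : ∀ v : V, β R v = 0)
    (ω : V →ₗ[ℝ] V →ₗ[ℝ] ℝ) (hω : ∀ v : V, ω v v = 0)
    (h1 : ∀ v₁ v₂ v₃ v₄ : V,
      wedge22 (fun v w => ω v w) (fun v w => β v w) v₁ v₂ v₃ v₄ = 0)
    (h2 : ¬ ∀ v₁ v₂ v₃ v₄ : V,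
      wedge22 (fun v w => ω v w) (fun v w => ω v w) v₁ v₂ v₃ v₄ = 0) :
    ∀ v : V, ω R v = 0 := by
  by_contra! hne
  obtain ⟨v, hv⟩ := hne
  refine hcontact (wedge122_self_eq_zero_of_decomposable _ (fun a => ω R a)
    (fun b => β v b / ω R v) _ fun a b => ?_)
  have h := h1 R v a b
  simp only [wedge22, hR2, mul_zero, add_zero, sub_zero] at h
  field_simp
  linarith
end

section
/- Let V be a real vector space, β an alternating bilinear form on V, and I, J linear endomorphisms of V with I² = −Id and J² = −Id. Assume: β(Iv, Iw) = β(v, w) for all v, w; the bilinear form g(v, w) := β(v, Iw) satisfies g(v, v) > 0 for all v ≠ 0; β(Jv, Jw) = −β(v, w) for all v, w (anti-compatibility); and g(Jv, Jw) = g(v, w) for all v, w (J is g-orthogonal). Then (I ∘ J) ∘ (I ∘ J) = −Id and I ∘ J = −J ∘ I; in particular {Id, I, J, IJ} form a quaternionic structure on V. -/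
/-- If `I` is an almost complex structure compatible with the alternating form `β`
(with positive definite `g(v,w) = β(v, Iw)`), and `J` is an almost complex structure
anti-compatible with `β` and orthogonal for `g`, then `(I∘J)² = −Id` and `IJ = −JI`;
in particular `{Id, I, J, IJ}` form a quaternionic structure. -/
theorem stmt12 (V : Type*) [AddCommGroup V] [Module ℝ V]
    (β : V →ₗ[ℝ] V →ₗ[ℝ] ℝ) (halt : ∀ v : V, β v v = 0)
    (I J : V →ₗ[ℝ] V)
    (hI2 : ∀ v : V, I (I v) = -v) (hJ2 : ∀ v : V, J (J v) = -v)
    (hIcomp : ∀ v w : V, β (I v) (I w) = β v w)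
    (hpos : ∀ v : V, v ≠ 0 → 0 < β v (I v))
    (hJanti : ∀ v w : V, β (J v) (J w) = -β v w)
    (hJorth : ∀ v w : V, β (J v) (I (J w)) = β v (I w)) :
    (∀ v : V, I (J (I (J v))) = -v) ∧ (∀ v : V, I (J v) = -(J (I v))) := by
  have hperp : ∀ x w : V, β x (I (J w) + J (I w)) = 0 := by
    intro x w
    have h₁ := hJorth (-(J x)) w
    have h₂ := hJanti (-(J x)) (I w)
    simp only [map_neg, hJ2, neg_neg] at h₁ h₂
    rw [map_add, h₁, h₂, add_neg_cancel]
  have hanti : ∀ v : V, I (J v) = -(J (I v)) := by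
    intro v
    rw [eq_neg_iff_add_eq_zero]
    by_contra hne
    have h := hpos _ hne
    rw [← hIcomp, hI2, map_neg, hperp, neg_zero] at h
    exact lt_irrefl _ h
  refine ⟨fun v => ?_, hanti⟩
  rw [hanti (I (J v)), hI2, map_neg, hJ2, neg_neg]
end

section
/- Let V, β, I, J, g be as follows: β an alternating bilinear form on V, I² = −Id with β(Iv,Iw)=β(v,w) and g(v,w) := β(v,Iw) positive definite, J² = −Id with β(Jv,Jw) = −β(v,w) and g(Jv,Jw) = g(v,w). Define Ω(X, Y) := β(X, (J∘I)(Y)). Then: (a) Ω is alternating (Ω(Y,X) = −Ω(X,Y)); (b) Ω is J-invariant: Ω(JX, JY) = Ω(X, Y) for all X, Y; (c) Ω(X, JX) = g(X, X), hence Ω(X, JX) > 0 for every X ≠ 0. -/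
/-- With `I` compatible with the alternating form `β` (and `g(v,w) := β(v,Iw)` positive
definite), and `J` anti-compatible with `β` and `g`-orthogonal, the 2-form
`Ω(X,Y) := β(X, (J∘I)Y)` is alternating, `J`-invariant, and satisfies
`Ω(X, JX) = g(X,X) > 0` for `X ≠ 0`. -/
theorem stmt13 (V : Type*) [AddCommGroup V] [Module ℝ V]
    (β : V →ₗ[ℝ] V →ₗ[ℝ] ℝ) (halt : ∀ v : V, β v v = 0)
    (I J : V →ₗ[ℝ] V)
    (hI2 : ∀ v : V, I (I v) = -v) (hJ2 : ∀ v : V, J (J v) = -v)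
    (hIcomp : ∀ v w : V, β (I v) (I w) = β v w)
    (hpos : ∀ v : V, v ≠ 0 → 0 < β v (I v))
    (hJanti : ∀ v w : V, β (J v) (J w) = -β v w)
    (hJorth : ∀ v w : V, β (J v) (I (J w)) = β v (I w)) :
    (∀ X Y : V, β Y (J (I X)) = -β X (J (I Y))) ∧
    (∀ X Y : V, β (J X) (J (I (J Y))) = β X (J (I Y))) ∧
    (∀ X : V, β X (J (I (J X))) = β X (I X)) ∧
    (∀ X : V, X ≠ 0 → 0 < β X (J (I (J X)))) := by
  have hskew : ∀ v w : V, β v w = -β w v := fun v w => by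
    have h := halt (v + w)
    simp only [map_add, LinearMap.add_apply, halt] at h
    linarith
  have hnondeg : ∀ x : V, (∀ u : V, β u x = 0) → x = 0 := fun x hx => by
    by_contra hne
    have h := hpos x hne
    rw [hskew, hx] at h
    simp at h
  have hanti : ∀ w : V, J (I w) = -I (J w) := fun w => by
    refine eq_neg_of_add_eq_zero_left (hnondeg _ fun u => ?_)
    have h₁ := hJorth (J u) w
    have h₂ := hJanti (J u) (I w)
    simp only [hJ2, map_neg, LinearMap.neg_apply] at h₁ h₂
    rw [map_add]
    linarith
  have hJIJ : ∀ X : V, J (I (J X)) = I X := fun X => by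
    rw [hanti, hJ2, map_neg, neg_neg]
  have hmove : ∀ X Y : V, β (J X) (I Y) = β X (J (I Y)) := fun X Y => by
    have h := hJanti X (J (I Y))
    rw [hJ2, map_neg] at h
    exact neg_injective h
  refine ⟨fun X Y => ?_, fun X Y => ?_, fun X => ?_, fun X hX => ?_⟩
  · have h := hIcomp (I X) (J Y)
    rw [hI2, map_neg, LinearMap.neg_apply] at h
    rw [← hmove, hskew, hanti Y, map_neg, ← h]
  · rw [hJIJ, hmove]
  · rw [hJIJ]
  · rw [hJIJ]
    exact hpos X hX
end

section
/- Let V, β, I, J, g be as follows: β an alternating bilinear form on V, I² = −Id with β(Iv,Iw)=β(v,w) and g(v,w) := β(v,Iw) positive definite, J² = −Id with β(Jv,Jw) = −β(v,w) and g(Jv,Jw) = g(v,w). Define Ω(X, Y) := β(X, (J∘I)(Y)). Then Ω is a semi-calibrating form: for all v, w ∈ V with g(v,v) = g(w,w) = 1, one has Ω(v, w) ≤ 1, with equality Ω(v, w) = 1 if and only if w = Jv. In particular a 2-plane is Ω-calibrated exactly when it is J-invariant. -/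
/-- With `I` compatible with the alternating form `β` (and `g(v,w) := β(v,Iw)` positive
definite), and `J` anti-compatible with `β` and `g`-orthogonal, the 2-form
`Ω(X,Y) := β(X, (J∘I)Y)` is a semi-calibration: for `g`-unit vectors `v, w` one has
`Ω(v,w) ≤ 1`, with equality iff `w = Jv` (so the `Ω`-calibrated 2-planes are exactly the
`J`-invariant ones). -/
theorem stmt14 (V : Type*) [AddCommGroup V] [Module ℝ V]
    (β : V →ₗ[ℝ] V →ₗ[ℝ] ℝ) (halt : ∀ v : V, β v v = 0)
    (I J : V →ₗ[ℝ] V)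
    (hI2 : ∀ v : V, I (I v) = -v) (hJ2 : ∀ v : V, J (J v) = -v)
    (hIcomp : ∀ v w : V, β (I v) (I w) = β v w)
    (hpos : ∀ v : V, v ≠ 0 → 0 < β v (I v))
    (hJanti : ∀ v w : V, β (J v) (J w) = -β v w)
    (hJorth : ∀ v w : V, β (J v) (I (J w)) = β v (I w)) :
    ∀ v w : V, β v (I v) = 1 → β w (I w) = 1 →
      β v (J (I w)) ≤ 1 ∧ (β v (J (I w)) = 1 ↔ w = J v) := by
  intro v w hv hw
  have skew (a b : V) : β a b = -β b a := by
    have h := halt (a + b)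
    simp only [map_add, LinearMap.add_apply, halt] at h
    linarith
  have hΩ : β v (J (I w)) = β (J v) (I w) := by
    have h := hJanti v (J (I w))
    rw [hJ2, map_neg] at h
    linarith
  have hsymm : β w (I (J v)) = β (J v) (I w) := by
    rw [← hIcomp, hI2, map_neg, ← skew]
  have hJv : β (J v) (I (J v)) = 1 := (hJorth v v).trans hv
  have hdist : β (w - J v) (I (w - J v)) = 2 - 2 * β v (J (I w)) := by
    simp only [map_sub, LinearMap.sub_apply, hΩ, hsymm, hw, hJv]
    ring
  by_cases hwv : w = J v
  · have h1 : β v (J (I w)) = 1 := by rw [hΩ, hwv, hJv]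
    exact ⟨h1.le, fun _ => hwv, fun _ => h1⟩
  · have h := hpos _ (sub_ne_zero.mpr hwv)
    rw [hdist] at h
    exact ⟨by linarith, fun h1 => by linarith, fun h2 => absurd h2 hwv⟩
end

section
/- Let f₁, f₂, f₃, f₄ be the standard basis of ℝ⁴ and let ω₀ be the alternating bilinear form with ω₀(f₁,f₂) = 1, ω₀(f₃,f₄) = 1, and ω₀(fᵢ,fⱼ) = 0 for all other pairs i < j. Let J be a linear endomorphism of ℝ⁴ with J² = −Id and ω₀(v, Jv) = 0 for every v. Write Jf₁ = σf₁ + τf₂ + βf₃ + γf₄ and let δ be the f₁-coefficient of Jf₃. If γ ≠ 0, then τ = 0 and J is completely determined: Jf₁ = σf₁ + βf₃ + γf₄; Jf₃ = δf₁ − γf₂ − σf₃; Jf₂ = σf₂ + ((1+σ²+βδ)/γ)f₃ + δf₄; Jf₄ = −((1+σ²+βδ)/γ)f₁ + βf₂ − σf₄. -/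
/-- Standard symplectic form `ω₀ = dx¹∧dy¹ + dx²∧dy²` on `ℝ⁴`, with basis indices
`0 ↦ f₁ = ∂x₁`, `1 ↦ f₂ = ∂y₁`, `2 ↦ f₃ = ∂x₂`, `3 ↦ f₄ = ∂y₂`. -/
def omegaStd (v w : Fin 4 → ℝ) : ℝ :=
  (v 0 * w 1 - v 1 * w 0) + (v 2 * w 3 - v 3 * w 2)

/-- Standard basis vector `fᵢ` of `ℝ⁴`. -/
def f (i : Fin 4) : Fin 4 → ℝ := Pi.single i 1

/-- An almost complex structure `J` on `ℝ⁴` with `J² = −Id` and `ω₀(v, Jv) = 0` for all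
`v`, with `Jf₁ = σf₁ + τf₂ + βf₃ + γf₄` and `δ` the `f₁`-coefficient of `Jf₃`, satisfies
(when `γ ≠ 0`): `τ = 0` and `J` is completely determined by `σ, β, γ, δ` as in the
statement. -/
theorem stmt16 (J : (Fin 4 → ℝ) →ₗ[ℝ] (Fin 4 → ℝ))
    (hJ2 : ∀ v : Fin 4 → ℝ, J (J v) = -v)
    (hlagr : ∀ v : Fin 4 → ℝ, omegaStd v (J v) = 0)
    (σ τ β γ δ : ℝ)
    (hσ : σ = J (f 0) 0) (hτ : τ = J (f 0) 1)
    (hβ : β = J (f 0) 2) (hγ : γ = J (f 0) 3)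
    (hδ : δ = J (f 2) 0)
    (hγ0 : γ ≠ 0) :
    τ = 0 ∧
    J (f 0) = σ • f 0 + β • f 2 + γ • f 3 ∧
    J (f 2) = δ • f 0 - γ • f 1 - σ • f 2 ∧
    J (f 1) = σ • f 1 + ((1 + σ ^ 2 + β * δ) / γ) • f 2 + δ • f 3 ∧
    J (f 3) = -((1 + σ ^ 2 + β * δ) / γ) • f 0 + β • f 1 - σ • f 3 := by
  have polar : ∀ v w, omegaStd v (J w) + omegaStd w (J v) = 0 := by
    intro v w
    have h := hlagr (v + w)
    have hv := hlagr v
    have hw := hlagr w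
    simp only [omegaStd, map_add, Pi.add_apply] at h hv hw ⊢
    linarith
  have h00 := hlagr (f 0)
  have h11 := hlagr (f 1)
  have h22 := hlagr (f 2)
  have h33 := hlagr (f 3)
  have h01 := polar (f 0) (f 1)
  have h02 := polar (f 0) (f 2)
  have h03 := polar (f 0) (f 3)
  have h12 := polar (f 1) (f 2)
  have h13 := polar (f 1) (f 3)
  have h23 := polar (f 2) (f 3)
  have expand : ∀ v, J v = v 0 • J (f 0) + v 1 • J (f 1) + v 2 • J (f 2) + v 3 • J (f 3) := by
    intro v
    rw [← map_smul, ← map_smul, ← map_smul, ← map_smul, ← map_add, ← map_add, ← map_add]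
    congr 1
    ext i
    fin_cases i <;> simp [f]
  have hsq := hJ2 (f 0)
  rw [expand (J (f 0))] at hsq
  have hsq0 := congrFun hsq 0
  have hsq3 := congrFun hsq 3
  generalize J (f 0) = a at *
  generalize J (f 1) = b at *
  generalize J (f 2) = c at *
  generalize J (f 3) = d at *
  simp [omegaStd, f] at h00 h11 h22 h33 h01 h02 h03 h12 h13 h23 hsq0 hsq3
  have hτ0 : τ = 0 := by linarith
  have hc2 : c 2 = -σ := by
    apply mul_left_cancel₀ hγ0
    rw [h00, h22] at hsq3
    have hd3 : d 3 = c 2 := by linarith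
    rw [hd3, ← hγ, ← hσ] at hsq3
    linarith
  have hb2 : b 2 = (1 + σ ^ 2 + β * δ) / γ := by
    rw [eq_div_iff hγ0]
    have hd0 : d 0 = -b 2 := by linarith
    rw [h00, hd0, ← hγ, ← hσ, ← hβ, ← hδ] at hsq0
    linarith
  rw [← hb2]
  refine ⟨hτ0, ?_, ?_, ?_, ?_⟩ <;> ext i <;> fin_cases i <;>
    simp [f] <;> linarith
end
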